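/- Let μ : [0,∞) → ℝ be continuous. The scalar linear time-varying system ẏ(t) = μ(t)y(t) is globally uniformly asymptotically stable — that is, there exists a class-KL function σ such that |y0| · exp(∫_{t0}^{t} μ(s) ds) ≤ σ(|y0|, t − t0) for all t ≥ t0 ≥ 0 and all y0 ∈ ℝ — if and only if there exist constants ε > 0 and δ ≥ 0 such that ∫_{t0}^{t} μ(s) ds ≤ −ε(t − t0) + δ for all t ≥ t0 ≥ 0. -/

import Mathlib

/-- A class-K function: continuous, strictly increasing on `[0,∞)`, vanishing at `0`,
and `[0,∞)`-valued on `[0,∞)`. -/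
def IsClassK (γ : ℝ → ℝ) : Prop :=
  ContinuousOn γ (Set.Ici 0) ∧ StrictMonoOn γ (Set.Ici 0) ∧ γ 0 = 0 ∧ ∀ s ≥ (0:ℝ), 0 ≤ γ s

/-- A class-KL function. -/
def IsClassKL (σ : ℝ → ℝ → ℝ) : Prop :=
  (∀ t ≥ (0:ℝ), IsClassK fun s => σ s t) ∧
  ∀ s ≥ (0:ℝ), AntitoneOn (σ s) (Set.Ici 0) ∧
    Filter.Tendsto (σ s) Filter.atTop (nhds 0)

/-- The scalar linear time-varying system `ẏ = μ(t) y` is globally uniformly asymptotically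
stable (every solution `y(t) = y0 · exp(∫_{t0}^t μ)` is bounded by a class-KL function of
`(|y0|, t - t0)`) if and only if there are `ε > 0` and `δ ≥ 0` with
`∫_{t0}^t μ(s) ds ≤ -ε (t - t0) + δ` for all `t ≥ t0 ≥ 0`. -/
theorem usf_iff_guas (μ : ℝ → ℝ) (hμ : ContinuousOn μ (Set.Ici 0)) :
    (∃ σ : ℝ → ℝ → ℝ, IsClassKL σ ∧
      ∀ t0 t y0 : ℝ, 0 ≤ t0 → t0 ≤ t →
        |y0| * Real.exp (∫ s in t0..t, μ s) ≤ σ |y0| (t - t0)) ↔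
    (∃ ε > (0:ℝ), ∃ δ ≥ (0:ℝ), ∀ t0 t : ℝ, 0 ≤ t0 → t0 ≤ t →
      (∫ s in t0..t, μ s) ≤ -ε * (t - t0) + δ) := by
  constructor
  · rintro ⟨σ, ⟨-, hσ⟩, h⟩
    obtain ⟨hanti, hlim⟩ := hσ 1 zero_le_one
    have h1 : ∀ t0 t : ℝ, 0 ≤ t0 → t0 ≤ t →
        Real.exp (∫ s in t0..t, μ s) ≤ σ 1 (t - t0) := by
      intro t0 t h0 ht
      simpa using h t0 t 1 h0 ht
    have hint : ∀ a b : ℝ, 0 ≤ a → a ≤ b → IntervalIntegrable μ MeasureTheory.volume a b := by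
      intro a b ha hab
      apply ContinuousOn.intervalIntegrable
      apply hμ.mono
      intro x hx
      rw [Set.uIcc_of_le hab] at hx
      exact ha.trans hx.1
    have hone : 1 ≤ σ 1 0 := by simpa using h1 0 0 le_rfl le_rfl
    have hC : ∀ t0 t : ℝ, 0 ≤ t0 → t0 ≤ t → (∫ s in t0..t, μ s) ≤ Real.log (σ 1 0) := by
      intro t0 t h0 ht
      rw [Real.le_log_iff_exp_le (by linarith)]
      exact (h1 t0 t h0 ht).trans
        (hanti (Set.mem_Ici.2 le_rfl) (Set.mem_Ici.2 (sub_nonneg.2 ht)) (sub_nonneg.2 ht))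
    obtain ⟨T, hTs, hT⟩ := ((hlim.eventually (gt_mem_nhds (Real.exp_pos (-1)))).and
      (Filter.eventually_gt_atTop 0)).exists
    have hstep : ∀ t0 : ℝ, 0 ≤ t0 → (∫ s in t0..(t0 + T), μ s) ≤ -1 := by
      intro t0 h0
      have := h1 t0 (t0 + T) h0 (by linarith)
      rw [add_sub_cancel_left] at this
      exact Real.exp_le_exp.1 (this.trans hTs.le)
    have hind : ∀ n : ℕ, ∀ t0 t : ℝ, 0 ≤ t0 → t0 + n * T ≤ t →
        (∫ s in t0..t, μ s) ≤ -n + Real.log (σ 1 0) := by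
      intro n
      induction n with
      | zero =>
        intro t0 t h0 ht
        simpa using hC t0 t h0 (by simpa using ht)
      | succ k ih =>
        intro t0 t h0 ht
        push_cast at ht ⊢
        have hk : 0 ≤ (k : ℝ) * T := by positivity
        have a1 := ih (t0 + T) t (by linarith) (by linarith)
        have a2 := hstep t0 h0
        rw [← intervalIntegral.integral_add_adjacent_intervals
          (hint t0 (t0 + T) h0 (by linarith)) (hint (t0 + T) t (by linarith) (by linarith))]
        linarith
    refine ⟨1 / T, by positivity, 1 + Real.log (σ 1 0), ?_, ?_⟩
    · have := Real.log_nonneg hone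
      linarith
    · intro t0 t h0 ht
      have hq : 0 ≤ (t - t0) / T := div_nonneg (by linarith) hT.le
      have hf := Nat.floor_le hq
      have hl := Nat.lt_floor_add_one ((t - t0) / T)
      have hf' := (le_div_iff₀ hT).1 hf
      have := hind _ t0 t h0 (by linarith)
      have e : -(1 / T) * (t - t0) = -((t - t0) / T) := by ring
      rw [e]
      linarith
  · rintro ⟨ε, hε, δ, hδ, h⟩
    refine ⟨fun s t => s * Real.exp (-ε * t + δ), ⟨?_, ?_⟩, ?_⟩
    · intro t ht
      refine ⟨by fun_prop, ?_, by simp, fun s hs => by positivity⟩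
      intro a _ b _ hab
      exact mul_lt_mul_of_pos_right hab (Real.exp_pos _)
    · intro s hs
      constructor
      · intro a _ b _ hab
        apply mul_le_mul_of_nonneg_left _ hs
        apply Real.exp_le_exp.2
        nlinarith
      · have h1 : Filter.Tendsto (fun t : ℝ => -ε * t + δ) Filter.atTop Filter.atBot :=
          Filter.tendsto_atBot_add_const_right _ _
            (Filter.tendsto_id.const_mul_atTop_of_neg (by linarith))
        simpa using (Real.tendsto_exp_atBot.comp h1).const_mul s
    · intro t0 t y0 h0 ht
      exact mul_le_mul_of_nonneg_left (Real.exp_le_exp.2 (h t0 t h0 ht)) (abs_nonneg _)
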